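/- Let u ≠ 0 in ℝⁿ, F = {x ∈ ℝⁿ : ⟨x,u⟩ = 0}, F₁ = {x ∈ ℝⁿ : ⟨x,u⟩ = 1}, and let A be a real symmetric n×n matrix of strict negative type on F but not of negative type on ℝⁿ. Let M = sup_{x ∈ F₁} ⟨Ax,x⟩ and let z ∈ F₁ be the unique element with ⟨Az,z⟩ = M. Then the matrix B = (1/M)·z·zᵀ − A⁻¹ is positive semi-definite on ℝⁿ and its kernel equals the one-dimensional span of u. -/

import Mathlib

open Matrix

theorem Matrix.IsSymm.mulVec_dotProduct_comm {m R : Type*} [Fintype m] [CommSemiring R]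
    {A : Matrix m m R} (hA : A.IsSymm) (x y : m → R) :
    A.mulVec x ⬝ᵥ y = A.mulVec y ⬝ᵥ x := by
  rw [dotProduct_comm, dotProduct_mulVec, ← mulVec_transpose, hA.eq]

/-- If `A z = m u` and `⟨z,u⟩ = 1`, the quadratic form of `A` splits along `ℝ z ⊕ u^⊥`. -/
theorem Matrix.IsSymm.mulVec_dotProduct_self_split {ι R : Type*} [Fintype ι] [CommRing R]
    {A : Matrix ι ι R} (hA : A.IsSymm) {u z : ι → R} {m : R}
    (hz : z ⬝ᵥ u = 1) (hAz : A.mulVec z = m • u) (x : ι → R) :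
    A.mulVec x ⬝ᵥ x = (x ⬝ᵥ u) ^ 2 * m +
      A.mulVec (x - (x ⬝ᵥ u) • z) ⬝ᵥ (x - (x ⬝ᵥ u) • z) := by
  have hzx : A.mulVec z ⬝ᵥ x = m * (x ⬝ᵥ u) := by
    rw [hAz, smul_dotProduct, smul_eq_mul, dotProduct_comm]
  have hxz : A.mulVec x ⬝ᵥ z = m * (x ⬝ᵥ u) := by
    rw [hA.mulVec_dotProduct_comm, hzx]
  have hzz : A.mulVec z ⬝ᵥ z = m := by
    rw [hAz, smul_dotProduct, smul_eq_mul, dotProduct_comm, hz, mul_one]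
  simp only [mulVec_sub, mulVec_smul, sub_dotProduct, dotProduct_sub, smul_dotProduct,
    dotProduct_smul, smul_eq_mul, hzx, hxz, hzz]
  ring

theorem sub_dotProduct_smul_dotProduct_eq_zero {ι R : Type*} [Fintype ι] [CommRing R]
    {u z : ι → R} (hz : z ⬝ᵥ u = 1) (x : ι → R) : (x - (x ⬝ᵥ u) • z) ⬝ᵥ u = 0 := by
  simp [sub_dotProduct, smul_dotProduct, hz]

/-- A symmetric matrix of strict negative type on `u^⊥` but not of negative type is invertible. -/
theorem Matrix.IsSymm.isUnit_det_of_strict_negative_type {ι : Type*} [Fintype ι] [DecidableEq ι]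
    {A : Matrix ι ι ℝ} (hA : A.IsSymm) {u : ι → ℝ}
    (hneg : ∀ x : ι → ℝ, x ⬝ᵥ u = 0 → A.mulVec x ⬝ᵥ x ≤ 0)
    (hstrict : ∀ x : ι → ℝ, x ⬝ᵥ u = 0 → A.mulVec x ⬝ᵥ x = 0 → x = 0)
    (hnot : ∃ w : ι → ℝ, 0 < A.mulVec w ⬝ᵥ w) : IsUnit A.det := by
  rw [isUnit_iff_ne_zero]
  intro hdet
  obtain ⟨x, hx0, hAx⟩ := exists_mulVec_eq_zero_iff.mpr hdet
  have hxu : x ⬝ᵥ u ≠ 0 := fun h => hx0 (hstrict x h (by rw [hAx, zero_dotProduct]))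
  obtain ⟨w, hw⟩ := hnot
  have hz : ((x ⬝ᵥ u)⁻¹ • x) ⬝ᵥ u = 1 := by
    rw [smul_dotProduct, smul_eq_mul, inv_mul_cancel₀ hxu]
  have hAz : A.mulVec ((x ⬝ᵥ u)⁻¹ • x) = (0 : ℝ) • u := by
    rw [mulVec_smul, hAx, smul_zero, zero_smul]
  have h1 := hA.mulVec_dotProduct_self_split hz hAz w
  have h2 := hneg _ (sub_dotProduct_smul_dotProduct_eq_zero hz w)
  linarith

/-- With `M = sup_{x ∈ F₁} ⟨Ax,x⟩` and `z ∈ F₁` the unique maximal element,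
the matrix `B = (1/M)·zzᵀ − A⁻¹` is positive semi-definite on `ℝⁿ` and its kernel is the
one-dimensional span of `u`. -/
theorem gap_B_psd_ker {n : ℕ} (u : Fin n → ℝ) (hu : u ≠ 0)
    (A : Matrix (Fin n) (Fin n) ℝ) (hA : A.IsSymm)
    (hneg : ∀ x : Fin n → ℝ, x ⬝ᵥ u = 0 → A.mulVec x ⬝ᵥ x ≤ 0)
    (hstrict : ∀ x : Fin n → ℝ, x ⬝ᵥ u = 0 → A.mulVec x ⬝ᵥ x = 0 → x = 0)
    (hnot : ∃ w : Fin n → ℝ, 0 < A.mulVec w ⬝ᵥ w)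
    (M : ℝ) (hM : M = sSup {r : ℝ | ∃ x : Fin n → ℝ, x ⬝ᵥ u = 1 ∧ r = A.mulVec x ⬝ᵥ x})
    (z : Fin n → ℝ) (hz : z ⬝ᵥ u = 1) (hzM : A.mulVec z ⬝ᵥ z = M)
    (B : Matrix (Fin n) (Fin n) ℝ) (hB : B = (1 / M) • vecMulVec z z - A⁻¹) :
    (∀ x : Fin n → ℝ, 0 ≤ B.mulVec x ⬝ᵥ x) ∧
    (∀ x : Fin n → ℝ, B.mulVec x = 0 ↔ ∃ c : ℝ, x = c • u) := by
  have hdet := hA.isUnit_det_of_strict_negative_type hneg hstrict hnot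
  have hinv : ∀ x, A.mulVec (A⁻¹.mulVec x) = x := fun x => by
    rw [mulVec_mulVec, mul_nonsing_inv A hdet, one_mulVec]
  have hinv' : ∀ x, A⁻¹.mulVec (A.mulVec x) = x := fun x => by
    rw [mulVec_mulVec, nonsing_inv_mul A hdet, one_mulVec]
  have hAz : A.mulVec z = M • u := by
    set v := A⁻¹.mulVec u with hv
    have hvu : v ⬝ᵥ u ≠ 0 := by
      intro h
      have hv0 := hstrict v h (by rw [hinv, dotProduct_comm, h])
      exact hu (by rw [← hinv u, ← hv, hv0, mulVec_zero])
    set z' := (v ⬝ᵥ u)⁻¹ • v with hz'def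
    have hz' : z' ⬝ᵥ u = 1 := by
      rw [hz'def, smul_dotProduct, smul_eq_mul, inv_mul_cancel₀ hvu]
    have hAz' : A.mulVec z' = (v ⬝ᵥ u)⁻¹ • u := by rw [hz'def, mulVec_smul, hinv]
    have hsplit := hA.mulVec_dotProduct_self_split hz' hAz'
    have hgreatest : IsGreatest {r : ℝ | ∃ x : Fin n → ℝ, x ⬝ᵥ u = 1 ∧ r = A.mulVec x ⬝ᵥ x}
        (v ⬝ᵥ u)⁻¹ := by
      refine ⟨⟨z', hz', ?_⟩, ?_⟩
      · rw [hAz', smul_dotProduct, dotProduct_comm u z', hz', smul_eq_mul, mul_one]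
      · rintro r ⟨x, hx, rfl⟩
        have h1 := hsplit x
        have h2 := hneg _ (sub_dotProduct_smul_dotProduct_eq_zero hz' x)
        rw [hx] at h1 h2
        linarith
    have hMv : M = (v ⬝ᵥ u)⁻¹ := hM.trans hgreatest.csSup_eq
    have h1 := hsplit z
    have h2 := hstrict _ (sub_dotProduct_smul_dotProduct_eq_zero hz' z)
    rw [hz, one_smul] at h1 h2
    have hzz' : z = z' := sub_eq_zero.mp (h2 (by linarith))
    rw [hzz', hAz', hMv]
  have hMpos : 0 < M := by
    obtain ⟨w, hw⟩ := hnot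
    have h1 := hA.mulVec_dotProduct_self_split hz hAz w
    have h2 := hneg _ (sub_dotProduct_smul_dotProduct_eq_zero hz w)
    exact pos_of_mul_pos_right (by linarith : 0 < (w ⬝ᵥ u) ^ 2 * M) (sq_nonneg _)
  have hzA : ∀ s, z ⬝ᵥ A.mulVec s = M * (s ⬝ᵥ u) := fun s => by
    rw [dotProduct_comm, hA.mulVec_dotProduct_comm, hAz, smul_dotProduct, smul_eq_mul,
      dotProduct_comm]
  have hBA : ∀ s, B.mulVec (A.mulVec s) = (s ⬝ᵥ u) • z - s := by
    intro s
    rw [hB, sub_mulVec, hinv', smul_mulVec, vecMulVec_mulVec, hzA, op_smul_eq_smul, smul_smul,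
      one_div, inv_mul_cancel_left₀ hMpos.ne']
  refine ⟨fun x => ?_, fun x => ⟨fun hx => ?_, ?_⟩⟩
  · obtain ⟨s, rfl⟩ : ∃ s, A.mulVec s = x := ⟨_, hinv x⟩
    have h1 := hA.mulVec_dotProduct_self_split hz hAz s
    have h2 := hneg _ (sub_dotProduct_smul_dotProduct_eq_zero hz s)
    rw [hBA, sub_dotProduct, smul_dotProduct, smul_eq_mul, hzA,
      dotProduct_comm s (A.mulVec s)]
    linarith
  · obtain ⟨s, rfl⟩ : ∃ s, A.mulVec s = x := ⟨_, hinv x⟩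
    rw [hBA, sub_eq_zero] at hx
    exact ⟨(s ⬝ᵥ u) * M, by rw [← smul_smul, ← hAz, ← mulVec_smul, hx]⟩
  · rintro ⟨c, rfl⟩
    have hBz := hBA z
    rw [hz, one_smul, sub_self, hAz, mulVec_smul] at hBz
    rw [mulVec_smul, (smul_eq_zero.mp hBz).resolve_left hMpos.ne', smul_zero]
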